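/- The natural action of 𝒢 on the coset space 𝒢 ⧸ 𝓜 is primitive (every 𝒢-invariant block of this action is trivial); equivalently, 𝓜 is a maximal subgroup of 𝒢. -/

import Mathlib

/-!
Symmetric generation of `M₂₂` (Hasan–Lim).  `G` is the quotient of the free
group on three generators `x, y, t` by the normal closure of the relators
`x^7, y^2, (xy)^3, [x,y]^4, t^2, [t^{x^2}, y x⁻¹], [t, y],
 (y t^{x^2})^5, (x y x^2 t^x)^5, (x t)^8`,
where `a ^ b := b⁻¹ a b` and `[a, b] := a⁻¹ b⁻¹ a b`.
-/

namespace M22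

abbrev F := FreeGroup (Fin 3)
def fx : F := FreeGroup.of 0
def fy : F := FreeGroup.of 1
def ft : F := FreeGroup.of 2

/-- conjugation `a ^ b = b⁻¹ * a * b` -/
def fconj (a b : F) : F := b⁻¹ * a * b
/-- commutator `[a, b] = a⁻¹ * b⁻¹ * a * b` -/
def fcomm (a b : F) : F := a⁻¹ * b⁻¹ * a * b

def rels : Set F :=
  {fx ^ 7, fy ^ 2, (fx * fy) ^ 3, (fcomm fx fy) ^ 4, ft ^ 2,
   fcomm (fconj ft (fx ^ 2)) (fy * fx⁻¹), fcomm ft fy,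
   (fy * fconj ft (fx ^ 2)) ^ 5, (fx * fy * fx ^ 2 * fconj ft fx) ^ 5,
   (fx * ft) ^ 8}

abbrev G := PresentedGroup rels

def x : G := PresentedGroup.of 0
def y : G := PresentedGroup.of 1
def t : G := PresentedGroup.of 2

/-- The symmetric generators `t₁, …, t₁₄`: for `1 ≤ i ≤ 7`, `tᵢ = t ^ (xⁱ)`,
and for `1 ≤ k ≤ 7`, `t₍₇₊ₖ₎ = t ^ (x⁵ y x^(k-1))`; the index is read modulo
`14` with representatives `1, …, 14`. -/
def tt (i : ℕ) : G :=
  let j := (i - 1) % 14 + 1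
  if j ≤ 7 then (x ^ j)⁻¹ * t * x ^ j
  else (x ^ 5 * y * x ^ (j - 8))⁻¹ * t * (x ^ 5 * y * x ^ (j - 8))

/-- `sᵢ = tᵢ t₍ᵢ₊₇₎`. -/
def s (i : ℕ) : G := tt i * tt (i + 7)

/-- the subgroup `𝓜 = ⟨x, y, s₁⟩` of `G`, where `s₁ = t₁ t₈` -/
def M : Subgroup G := Subgroup.closure {x, y, s 1}

namespace Chk

/-!
Certified coset enumeration of `G` over `M`.  A coset is named by a word (a list of letters, last
letter first); a partial coset table is stored in a trie; a log of elementary deduction steps is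
replayed by a verified checker.
-/

/-- Letters: `x`, `x⁻¹`, `y`, `t`, and a neutral letter used for aliases between coset names. -/
inductive L where
  | x | X | y | t | n

/-- Names of cosets. -/
abbrev Nm := List L

def L.inv : L → L
  | .x => .X
  | .X => .x
  | .y => .y
  | .t => .t
  | .n => .n

def gm : L → G
  | .x => M22.x
  | .X => M22.x⁻¹
  | .y => M22.y
  | .t => M22.t
  | .n => 1

def gw : List L → G
  | [] => 1
  | g :: w => gm g * gw w

def base : G ⧸ M := ((1 : G) : G ⧸ M)

/-- The coset with a given name. -/
noncomputable def e : Nm → G ⧸ M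
  | [] => base
  | g :: p => (gm g)⁻¹ • e p

/-! ### Tries -/

inductive Tr where
  | nil
  | node (a b c d m : Option Nm) (ca cb cc cd : Tr)

def Tr.kid : Tr → L → Tr
  | .nil, _ => .nil
  | .node _ _ _ _ _ ca cb cc cd, l =>
    match l with
    | .x => ca
    | .X => cb
    | .y => cc
    | .t => cd
    | .n => .nil

def Tr.fld : Tr → L → Option Nm
  | .nil, _ => none
  | .node a b c d m _ _ _ _, l =>
    match l with
    | .x => a
    | .X => b
    | .y => c
    | .t => d
    | .n => m

def Tr.setKid (T : Tr) (l : L) (U : Tr) : Tr :=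
  match T with
  | .nil =>
    match l with
    | .x => .node none none none none none U .nil .nil .nil
    | .X => .node none none none none none .nil U .nil .nil
    | .y => .node none none none none none .nil .nil U .nil
    | .t => .node none none none none none .nil .nil .nil U
    | .n => .nil
  | .node a b c d m ca cb cc cd =>
    match l with
    | .x => .node a b c d m U cb cc cd
    | .X => .node a b c d m ca U cc cd
    | .y => .node a b c d m ca cb U cd
    | .t => .node a b c d m ca cb cc U
    | .n => .node a b c d m ca cb cc cd

def Tr.setFld (T : Tr) (l : L) (v : Nm) : Tr :=
  match T with
  | .nil =>
    match l with
    | .x => .node (some v) none none none none .nil .nil .nil .nil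
    | .X => .node none (some v) none none none .nil .nil .nil .nil
    | .y => .node none none (some v) none none .nil .nil .nil .nil
    | .t => .node none none none (some v) none .nil .nil .nil .nil
    | .n => .node none none none none (some v) .nil .nil .nil .nil
  | .node a b c d m ca cb cc cd =>
    match l with
    | .x => .node (some v) b c d m ca cb cc cd
    | .X => .node a (some v) c d m ca cb cc cd
    | .y => .node a b (some v) d m ca cb cc cd
    | .t => .node a b c (some v) m ca cb cc cd
    | .n => .node a b c d (some v) ca cb cc cd

theorem kid_setKid (T : Tr) (l : L) (U : Tr) (l' : L) :
    (l = l' ∧ (T.setKid l U).kid l' = U) ∨ (T.setKid l U).kid l' = T.kid l' := by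
  cases T <;> cases l <;> cases l' <;> simp [Tr.setKid, Tr.kid]

theorem fld_setKid (T : Tr) (l : L) (U : Tr) (f : L) : (T.setKid l U).fld f = T.fld f := by
  cases T <;> cases l <;> cases f <;> rfl

theorem kid_setFld (T : Tr) (f : L) (v : Nm) (l : L) : (T.setFld f v).kid l = T.kid l := by
  cases T <;> cases l <;> cases f <;> rfl

theorem fld_setFld (T : Tr) (f : L) (v : Nm) (f' : L) :
    (f = f' ∧ (T.setFld f v).fld f' = some v) ∨ (T.setFld f v).fld f' = T.fld f' := by
  cases T <;> cases f <;> cases f' <;> simp [Tr.setFld, Tr.fld]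

def get : Nm → Tr → L → Option Nm
  | [], T, f => T.fld f
  | h :: r, T, f => get r (T.kid h) f

def set : Nm → L → Nm → Tr → Tr
  | [], f, v, T => T.setFld f v
  | h :: r, f, v, T => T.setKid h (set r f v (T.kid h))

theorem get_nil (k : Nm) (f : L) : get k .nil f = none := by
  induction k with
  | nil => rfl
  | cons h r ih => simpa [get, Tr.kid] using ih

theorem get_set (k : Nm) (f : L) (v : Nm) (T : Tr) (k' : Nm) (f' : L) (v' : Nm)
    (h : get k' (set k f v T) f' = some v') :
    (k = k' ∧ f = f' ∧ v = v') ∨ get k' T f' = some v' := by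
  induction k generalizing T k' with
  | nil =>
    cases k' with
    | nil =>
      simp only [get, set] at h ⊢
      rcases fld_setFld T f v f' with ⟨h1, h2⟩ | h2
      · rw [h2] at h
        exact Or.inl ⟨trivial, h1, Option.some.inj h⟩
      · rw [h2] at h
        exact Or.inr h
    | cons a r =>
      simp only [get, set, kid_setFld] at h ⊢
      exact Or.inr h
  | cons a r ih =>
    cases k' with
    | nil =>
      simp only [get, set, fld_setKid] at h ⊢
      exact Or.inr h
    | cons b r' =>
      simp only [get, set] at h ⊢
      rcases kid_setKid T a (set r f v (T.kid a)) b with ⟨h1, h2⟩ | h2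
      · rw [h2] at h
        subst h1
        rcases ih _ _ h with ⟨h3, h4⟩ | h3
        · exact Or.inl ⟨by rw [h3], h4⟩
        · exact Or.inr h3
      · rw [h2] at h
        exact Or.inr h

/-! ### Validity of a table -/

def Val (T : Tr) : Prop := ∀ k f v, get k T f = some v → e v = (gm f)⁻¹ • e k

theorem Val.set {T : Tr} (hT : Val T) {k : Nm} {f : L} {v : Nm}
    (h : e v = (gm f)⁻¹ • e k) : Val (set k f v T) := by
  intro k' f' v' h'
  rcases get_set _ _ _ _ _ _ _ h' with ⟨h1, h2, h3⟩ | h1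
  · rw [← h1, ← h2, ← h3]; exact h
  · exact hT _ _ _ h1

def nrm (T : Tr) : ℕ → Nm → Nm
  | 0, k => k
  | i + 1, k =>
    match get k T .n with
    | none => k
    | some u => nrm T i u

theorem e_nrm {T : Tr} (hT : Val T) (i : ℕ) (k : Nm) : e (nrm T i k) = e k := by
  induction i generalizing k with
  | zero => rfl
  | succ i ih =>
    unfold nrm
    split
    · rfl
    · next u hu => rw [ih, hT _ _ _ hu]; simp [gm]

def fwd (T : Tr) : List L → Nm → Option Nm
  | [], a => some (nrm T 4 a)
  | g :: w, a =>
    match get (nrm T 4 a) T g with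
    | none => none
    | some b => fwd T w b

theorem e_fwd {T : Tr} (hT : Val T) (w : List L) (a b : Nm) (h : fwd T w a = some b) :
    e b = (gw w)⁻¹ • e a := by
  induction w generalizing a with
  | nil =>
    simp only [fwd, Option.some.injEq] at h
    rw [← h, e_nrm hT]; simp [gw]
  | cons g w ih =>
    unfold fwd at h
    split at h
    · cases h
    · next c hc =>
      rw [ih _ h, hT _ _ _ hc, e_nrm hT, gw, mul_inv_rev, mul_smul]

def bwd (T : Tr) : List L → Nm → Option Nm
  | [], a => some (nrm T 4 a)
  | g :: w, a =>
    match bwd T w a with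
    | none => none
    | some b =>
      match get b T g.inv with
      | none => none
      | some c => some (nrm T 4 c)

theorem y_inv : (M22.y)⁻¹ = M22.y := by
  have h : (PresentedGroup.mk rels (fy ^ 2)) = 1 :=
    PresentedGroup.one_of_mem (by simp [rels])
  have h2 : M22.y * M22.y = 1 := by
    rw [map_pow, pow_two] at h; exact h
  exact inv_eq_of_mul_eq_one_left h2

theorem t_inv : (M22.t)⁻¹ = M22.t := by
  have h : (PresentedGroup.mk rels (ft ^ 2)) = 1 :=
    PresentedGroup.one_of_mem (by simp [rels])
  have h2 : M22.t * M22.t = 1 := by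
    rw [map_pow, pow_two] at h; exact h
  exact inv_eq_of_mul_eq_one_left h2

theorem gm_inv (g : L) : gm g.inv = (gm g)⁻¹ := by
  cases g <;> simp [gm, L.inv, y_inv, t_inv]

theorem e_bwd {T : Tr} (hT : Val T) (w : List L) (a b : Nm) (h : bwd T w a = some b) :
    e a = (gw w)⁻¹ • e b := by
  induction w generalizing b with
  | nil =>
    simp only [bwd, Option.some.injEq] at h
    rw [← h, e_nrm hT]; simp [gw]
  | cons g w ih =>
    unfold bwd at h
    split at h
    · cases h
    · next c hc =>
      split at h
      · cases h
      · next d hd =>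
        simp only [Option.some.injEq] at h
        rw [ih _ hc, ← h, e_nrm hT, hT _ _ _ hd, gm_inv, gw, mul_inv_rev, mul_smul, inv_inv,
          inv_smul_smul]

/-! ### Relators -/

def s1w : List L := [.X, .t, .x, .y, .X, .X, .X, .X, .X, .t, .x, .x, .x, .x, .x, .y]

def relw : ℕ → List L
  | 0 => [.x, .x, .x, .x, .x, .x, .x]
  | 1 => [.x, .y, .x, .y, .x, .y]
  | 2 => [.X, .y, .x, .y, .X, .y, .x, .y, .X, .y, .x, .y, .X, .y, .x, .y]
  | 3 => [.X, .X, .t, .x, .x, .x, .y, .X, .X, .t, .x, .x, .y, .X]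
  | 4 => [.t, .y, .t, .y]
  | 5 => [.y, .X, .X, .t, .x, .x, .y, .X, .X, .t, .x, .x, .y, .X, .X, .t, .x, .x, .y, .X, .X, .t, .x, .x, .y, .X, .X, .t, .x, .x]
  | 6 => [.x, .y, .x, .t, .x, .x, .y, .x, .t, .x, .x, .y, .x, .t, .x, .x, .y, .x, .t, .x, .x, .y, .x, .t, .x]
  | 7 => [.x, .t, .x, .t, .x, .t, .x, .t, .x, .t, .x, .t, .x, .t, .x, .t]
  | 8 => s1w
  | 9 => [.x, .X]
  | 10 => [.X, .x]
  | 11 => [.y, .y]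
  | 12 => [.t, .t]
  | _ => []

theorem rel_one {r : F} (h : r ∈ rels) : PresentedGroup.mk rels r = 1 :=
  PresentedGroup.one_of_mem h

theorem mk_fx : PresentedGroup.mk rels fx = M22.x := rfl
theorem mk_fy : PresentedGroup.mk rels fy = M22.y := rfl
theorem mk_ft : PresentedGroup.mk rels ft = M22.t := rfl

theorem gw_relw (r : ℕ) (hr : r ≠ 8) : gw (relw r) = 1 := by
  have h0 := rel_one (r := fx ^ 7) (by simp [rels])
  have h1 := rel_one (r := (fx * fy) ^ 3) (by simp [rels])
  have h2 := rel_one (r := (fcomm fx fy) ^ 4) (by simp [rels])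
  have h3 := rel_one (r := fcomm (fconj ft (fx ^ 2)) (fy * fx⁻¹)) (by simp [rels])
  have h4 := rel_one (r := fcomm ft fy) (by simp [rels])
  have h5 := rel_one (r := (fy * fconj ft (fx ^ 2)) ^ 5) (by simp [rels])
  have h6 := rel_one (r := (fx * fy * fx ^ 2 * fconj ft fx) ^ 5) (by simp [rels])
  have h7 := rel_one (r := (fx * ft) ^ 8) (by simp [rels])
  have hy : M22.y * M22.y = 1 := by
    nth_rewrite 1 [← y_inv]; simp
  have ht : M22.t * M22.t = 1 := by
    nth_rewrite 1 [← t_inv]; simp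
  simp only [fcomm, fconj, map_pow, map_mul, map_inv, mk_fx, mk_fy, mk_ft] at h0 h1 h2 h3 h4 h5 h6 h7
  match r with
  | 0 => simpa [relw, gw, gm, pow_succ, mul_assoc] using h0
  | 1 => simpa [relw, gw, gm, pow_succ, mul_assoc] using h1
  | 2 => simpa [relw, gw, gm, pow_succ, mul_assoc, y_inv] using h2
  | 3 => simpa [relw, gw, gm, pow_succ, mul_assoc, y_inv, t_inv] using h3
  | 4 => simpa [relw, gw, gm, pow_succ, mul_assoc, y_inv, t_inv] using h4
  | 5 => simpa [relw, gw, gm, pow_succ, mul_assoc] using h5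
  | 6 => simpa [relw, gw, gm, pow_succ, mul_assoc] using h6
  | 7 => simpa [relw, gw, gm, pow_succ, mul_assoc] using h7
  | 8 => exact absurd rfl hr
  | 9 => simp [relw, gw, gm]
  | 10 => simp [relw, gw, gm]
  | 11 => simp [relw, gw, gm, hy]
  | 12 => simp [relw, gw, gm, ht]
  | k + 13 => simp [relw, gw]

theorem smul_base {g : G} (h : g ∈ M) : g • base = base := by
  have : ((g * 1 : G) : G ⧸ M) = ((1 : G) : G ⧸ M) := by
    rw [QuotientGroup.eq]; simpa using h
  exact this

theorem x_mem : M22.x ∈ M := Subgroup.subset_closure (by simp)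
theorem y_mem : M22.y ∈ M := Subgroup.subset_closure (by simp)
theorem s1_mem : gw s1w ∈ M := by
  have h : s 1 ∈ M := Subgroup.subset_closure (by simp)
  have h2 : gw s1w = s 1 := by
    simp [s, tt, s1w, gw, gm, pow_succ, mul_assoc, y_inv]
  rw [h2]; exact h

def okr (r : ℕ) (a : Nm) : Bool := !(Nat.beq r 8) || a.isEmpty

theorem okr_spec {r : ℕ} {a : Nm} (h : okr r a = true) : (gw (relw r))⁻¹ • e a = e a := by
  by_cases hr : r = 8
  · subst hr
    have ha : a = [] := by simpa [okr] using h
    subst ha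
    exact smul_base (M.inv_mem s1_mem)
  · rw [gw_relw r hr]; simp

theorem gw_append (u v : List L) : gw (u ++ v) = gw u * gw v := by
  induction u with
  | nil => simp [gw]
  | cons a u ih => simp [gw, ih, mul_assoc]

/-! ### Steps -/

def letter : ℕ → L
  | 0 => .x
  | 1 => .X
  | 2 => .y
  | _ => .t

def dec : ℕ → ℕ → Nm
  | 0, _ => []
  | i + 1, c =>
    match c with
    | 0 => []
    | c' + 1 => letter (Nat.mod c' 5) :: dec i (Nat.div (c' + 1) 5)

def ded (T : Tr) (a : Nm) (r s : ℕ) : Option Tr :=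
  match okr r a with
  | false => none
  | true =>
    match fwd T ((relw r).take s) a, (relw r).drop s with
    | some p, g :: w =>
      match bwd T w a with
      | some q => some (set p g q (set q g.inv p T))
      | none => none
    | _, _ => none

theorem ded_val {T T' : Tr} (hT : Val T) {a : Nm} {r s : ℕ} (h : ded T a r s = some T') :
    Val T' := by
  unfold ded at h
  split at h
  · cases h
  next hok =>
  split at h
  · next p g w hp hd =>
    split at h
    · next q hq =>
      simp only [Option.some.injEq] at h
      have h1 := e_fwd hT _ _ _ hp
      have h2 := e_bwd hT _ _ _ hq
      have h3 := okr_spec hok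
      have h4 : gw (relw r) = gw ((relw r).take s) * (gm g * gw w) := by
        conv_lhs => rw [← List.take_append_drop s (relw r), gw_append, hd]
        rfl
      have h5 : e q = (gm g)⁻¹ • e p := by
        rw [h1]
        rw [h4, h2] at h3
        have h6 : e q = gw w • ((gw (List.take s (relw r)) * (gm g * gw w))⁻¹ • e a) := by
          rw [h2, h3]; simp
        rw [h6]
        simp [mul_smul]
      rw [← h]
      refine Val.set (Val.set hT ?_) h5
      rw [gm_inv, h5]; simp
    · cases h
  · cases h

def coin (T : Tr) (a : Nm) (r s : ℕ) : Option (Nm × Nm) :=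
  match okr r a with
  | false => none
  | true =>
    match fwd T ((relw r).take s) a, bwd T ((relw r).drop s) a with
    | some p, some q => some (p, q)
    | _, _ => none

theorem coin_val {T : Tr} (hT : Val T) {a : Nm} {r s : ℕ} {p q : Nm}
    (h : coin T a r s = some (p, q)) : e p = e q := by
  unfold coin at h
  split at h
  · cases h
  next hok =>
  split at h
  · next p' q' hp hq =>
    simp only [Option.some.injEq, Prod.mk.injEq] at h
    obtain ⟨rfl, rfl⟩ := h
    have h1 := e_fwd hT _ _ _ hp
    have h2 := e_bwd hT _ _ _ hq
    have h3 := okr_spec hok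
    rw [← List.take_append_drop s (relw r), gw_append, mul_inv_rev, mul_smul, ← h1, h2] at h3
    exact smul_left_cancel _ h3
  · cases h

def tcoin (T : Tr) (a : Nm) (g : L) : Option (Nm × Nm) :=
  match get a T g, get (nrm T 4 a) T g with
  | some p, some q => some (nrm T 4 p, nrm T 4 q)
  | _, _ => none

theorem tcoin_val {T : Tr} (hT : Val T) {a : Nm} {g : L} {p q : Nm}
    (h : tcoin T a g = some (p, q)) : e p = e q := by
  unfold tcoin at h
  split at h
  · next p' q' hp hq =>
    simp only [Option.some.injEq, Prod.mk.injEq] at h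
    obtain ⟨rfl, rfl⟩ := h
    rw [e_nrm hT, e_nrm hT, hT _ _ _ hp, hT _ _ _ hq, e_nrm hT]
  · cases h

def ident1 (T : Tr) : Option (Nm × Nm) → Option Tr
  | none => none
  | some (p, q) => some (set p .n q T)

def ident2 (T : Tr) : Option (Nm × Nm) → Option Tr
  | none => none
  | some (p, q) => some (set q .n p T)

theorem ident1_val {T T' : Tr} (hT : Val T) {o : Option (Nm × Nm)}
    (ho : ∀ p q, o = some (p, q) → e p = e q) (h : ident1 T o = some T') : Val T' := by
  rcases o with _ | ⟨p, q⟩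
  · cases h
  · simp only [ident1, Option.some.injEq] at h
    rw [← h]
    refine hT.set ?_
    simp [gm, ho p q rfl]

theorem ident2_val {T T' : Tr} (hT : Val T) {o : Option (Nm × Nm)}
    (ho : ∀ p q, o = some (p, q) → e p = e q) (h : ident2 T o = some T') : Val T' := by
  rcases o with _ | ⟨p, q⟩
  · cases h
  · simp only [ident2, Option.some.injEq] at h
    rw [← h]
    refine hT.set ?_
    simp [gm, ho p q rfl]

def trans1 (T : Tr) (a : Nm) (g : L) : Option Tr :=
  match get a T g with
  | none => none
  | some m => some (set (nrm T 4 a) g m T)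

theorem trans1_val {T T' : Tr} (hT : Val T) {a : Nm} {g : L} (h : trans1 T a g = some T') :
    Val T' := by
  unfold trans1 at h
  split at h
  · cases h
  · next m hm =>
    simp only [Option.some.injEq] at h
    rw [← h]
    refine hT.set ?_
    rw [e_nrm hT]
    exact hT _ _ _ hm

def stepAux (T : Tr) (a : Nm) (r s : ℕ) : ℕ → Option Tr
  | 0 => some (set a (letter r) (letter r :: a) (set (letter r :: a) (letter r).inv a T))
  | 1 => ded T a r s
  | 2 => ident1 T (coin T a r s)
  | 3 => ident2 T (coin T a r s)
  | 4 => ident1 T (tcoin T a (letter r))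
  | 5 => ident2 T (tcoin T a (letter r))
  | _ => trans1 T a (letter r)

theorem stepAux_val {T T' : Tr} (hT : Val T) {a : Nm} {r s k : ℕ}
    (h : stepAux T a r s k = some T') : Val T' := by
  unfold stepAux at h
  split at h
  · simp only [Option.some.injEq] at h
    rw [← h]
    refine (hT.set ?_).set rfl
    rw [gm_inv]
    simp [e]
  · exact ded_val hT h
  · exact ident1_val hT (fun p q => coin_val hT) h
  · exact ident2_val hT (fun p q => coin_val hT) h
  · exact ident1_val hT (fun p q => tcoin_val hT) h
  · exact ident2_val hT (fun p q => tcoin_val hT) h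
  · exact trans1_val hT h

def step (T : Tr) (c : ℕ) : Option Tr :=
  stepAux T (dec 30 (Nat.div c 4096)) (Nat.mod (Nat.div c 8) 16) (Nat.mod (Nat.div c 128) 32)
    (Nat.mod c 8)

def run : List ℕ → Tr → Option Tr
  | [], T => some T
  | c :: l, T =>
    match step T c with
    | none => none
    | some T' => run l T'

theorem run_val (l : List ℕ) {T T' : Tr} (hT : Val T) (h : run l T = some T') : Val T' := by
  induction l generalizing T with
  | nil =>
    simp only [run, Option.some.injEq] at h
    rw [← h]; exact hT
  | cons c l ih =>
    unfold run at h
    split at h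
    · cases h
    · next U hU => exact ih (stepAux_val hT hU) h

def T0 : Tr := set [] .x [] (set [] .X [] (set [] .y [] .nil))

theorem T0_val : Val T0 := by
  have h : Val .nil := by
    intro k f v h
    rw [get_nil] at h
    cases h
  refine Val.set (Val.set (Val.set h ?_) ?_) ?_
  · exact (smul_base (M.inv_mem y_mem)).symm
  · exact (smul_base (M.inv_mem (M.inv_mem x_mem))).symm
  · exact (smul_base (M.inv_mem x_mem)).symm

/-! ### Blocks -/

/-- Whenever a block contains the base point and `e k`, it is everything. -/
def Good (k : Nm) : Prop :=
  ∀ B : Set (G ⧸ M), MulAction.IsBlock G B → base ∈ B → e k ∈ B → B = Set.univ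

open Pointwise in
theorem univ_of_closed (S : Set (G ⧸ M)) (h0 : base ∈ S)
    (h : ∀ l : L, ∀ z ∈ S, (gm l)⁻¹ • z ∈ S) : S = Set.univ := by
  have key : ∀ g : G, ∀ z, g • z ∈ S ↔ z ∈ S := by
    let H : Subgroup G :=
      { carrier := {g | ∀ z, g • z ∈ S ↔ z ∈ S}
        mul_mem' := by
          intro a b ha hb z
          rw [mul_smul, ha, hb]
        one_mem' := by intro z; simp
        inv_mem' := by
          intro a ha z
          rw [← ha, smul_inv_smul] }
    have hl : ∀ l : L, gm l ∈ H := by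
      intro l z
      constructor
      · intro hz
        simpa using h l _ hz
      · intro hz
        have := h l.inv z hz
        rwa [gm_inv, inv_inv] at this
    have hH : ∀ j : Fin 3, (PresentedGroup.of j : G) ∈ H := by
      intro j
      fin_cases j
      · exact hl .x
      · exact hl .y
      · exact hl .t
    intro g
    exact PresentedGroup.generated_by rels H hH g
  ext z
  simp only [Set.mem_univ, iff_true]
  induction z using QuotientGroup.induction_on with
  | H g =>
    have : g • base = ((g : G) : G ⧸ M) := by
      change ((g * 1 : G) : G ⧸ M) = _
      rw [mul_one]
    rw [← this, key]
    exact h0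

open Pointwise in
theorem stab_mem {B : Set (G ⧸ M)} (hB : MulAction.IsBlock G B) (h0 : base ∈ B) {g : G}
    (hg : g • base ∈ B) : g ∈ MulAction.stabilizer G B := by
  rw [MulAction.mem_stabilizer_iff]
  exact MulAction.isBlock_iff_smul_eq_of_mem.mp hB h0 hg

theorem e_eq (k : Nm) : e k = (gw k.reverse)⁻¹ • base := by
  induction k with
  | nil => simp [e, gw]
  | cons a k ih => simp [e, gw, gw_append, ih, mul_smul]

/-- Words used for moving inside a block: generators of `M`, and the word of `p`. -/
def tok (p : Nm) : ℕ → List L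
  | 0 => [.x]
  | 1 => [.X]
  | 2 => [.y]
  | 3 => s1w
  | _ => p.reverse

def toks (p : Nm) : List ℕ → List L
  | [] => []
  | i :: l => tok p i ++ toks p l

theorem tok_mem (p : Nm) (i : ℕ) (hi : i < 4) : gw (tok p i) ∈ M := by
  match i with
  | 0 => simpa [tok, gw, gm] using x_mem
  | 1 => simpa [tok, gw, gm] using x_mem
  | 2 => simpa [tok, gw, gm] using y_mem
  | 3 => exact s1_mem
  | k + 4 => omega

open Pointwise in
theorem stab_M {B : Set (G ⧸ M)} (hB : MulAction.IsBlock G B) (h0 : base ∈ B) :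
    M ≤ MulAction.stabilizer G B := by
  intro m hm
  exact stab_mem hB h0 (by rw [smul_base hm]; exact h0)

open Pointwise in
theorem good_of_toks {T : Tr} (hT : Val T) (p : Nm) (l : List ℕ)
    (h : fwd T (toks p l) [] = some [.t]) : Good p := by
  intro B hB h0 hp
  have hM := stab_M hB h0
  have hpw : gw p.reverse ∈ MulAction.stabilizer G B := by
    rw [e_eq] at hp
    exact (Subgroup.inv_mem_iff _).mp (stab_mem hB h0 hp)
  have htok : ∀ i, gw (tok p i) ∈ MulAction.stabilizer G B := by
    intro i
    by_cases hi : i < 4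
    · exact hM (tok_mem p i hi)
    · match i with
      | k + 4 => exact hpw
      | 0 | 1 | 2 | 3 => omega
  have hl : gw (toks p l) ∈ MulAction.stabilizer G B := by
    clear h
    induction l with
    | nil => exact Subgroup.one_mem _
    | cons i l ih =>
      rw [toks, gw_append]
      exact Subgroup.mul_mem _ (htok i) ih
  have h1 := e_fwd hT _ _ _ h
  have h2 : (gm .t)⁻¹ • base ∈ B := by
    change e [.t] ∈ B
    rw [h1]
    have h3 := (Subgroup.inv_mem _ hl)
    rw [MulAction.mem_stabilizer_iff] at h3
    rw [← h3]
    exact Set.smul_mem_smul_set h0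
  have ht : (gm .t)⁻¹ ∈ MulAction.stabilizer G B := stab_mem hB h0 h2
  have hall : ∀ g : L, (gm g)⁻¹ ∈ MulAction.stabilizer G B := by
    intro g
    cases g
    · exact Subgroup.inv_mem _ (hM x_mem)
    · exact Subgroup.inv_mem _ (Subgroup.inv_mem _ (hM x_mem))
    · exact Subgroup.inv_mem _ (hM y_mem)
    · exact ht
    · exact Subgroup.inv_mem _ (Subgroup.one_mem _)
  refine univ_of_closed B h0 ?_
  intro g z hz
  have h3 := hall g
  rw [MulAction.mem_stabilizer_iff] at h3
  rw [← h3]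
  exact Set.smul_mem_smul_set hz

open Pointwise in
theorem good_of_M {T : Tr} (hT : Val T) {k q : Nm} {i : ℕ} (hi : i < 4)
    (h : fwd T (tok [] i) k = some q) (hq : Good q) : Good k := by
  intro B hB h0 hk
  refine hq B hB h0 ?_
  rw [e_fwd hT _ _ _ h]
  have h3 := stab_M hB h0 (M.inv_mem (tok_mem [] i hi))
  rw [MulAction.mem_stabilizer_iff] at h3
  rw [← h3]
  exact Set.smul_mem_smul_set hk

/-! ### Final checks -/

def isT : Option Nm → Bool
  | some [.t] => true
  | _ => false

theorem isT_spec {o : Option Nm} (h : isT o = true) : o = some [.t] := by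
  unfold isT at h
  split at h
  · rfl
  · cases h

/-- The four representatives of the nontrivial `M`-orbits with words reaching `t`. -/
def reps : List (ℕ × List ℕ) :=
  [(4, [4]), (109, [4, 1, 4, 1]), (2734, [4, 0, 4, 0, 4]), (68359, [4, 4, 0, 0, 4])]

def markReps (T : Tr) : List (ℕ × List ℕ) → Tr → List Nm → Option (Tr × List Nm)
  | [], U, ns => some (U, ns)
  | c :: l, U, ns =>
    match isT (fwd T (toks (dec 30 c.1) c.2) []) with
    | false => none
    | true => markReps T l (set (dec 30 c.1) .n [] U) (dec 30 c.1 :: ns)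

def markOrb (T : Tr) : List ℕ → Tr → List Nm → Option (Tr × List Nm)
  | [], U, ns => some (U, ns)
  | c :: l, U, ns =>
    match fwd T (tok [] (Nat.mod c 4)) (dec 30 (Nat.div c 4)) with
    | none => none
    | some q =>
      match get q U .n with
      | none => none
      | some _ => markOrb T l (set (dec 30 (Nat.div c 4)) .n [] U) (dec 30 (Nat.div c 4) :: ns)

def Marked (U : Tr) (ns : List Nm) : Prop :=
  ∀ k v, get k U .n = some v → Good k ∧ k ∈ ns

theorem Marked.set {U : Tr} {ns : List Nm} (h : Marked U ns) {k : Nm} (hk : Good k) (v : Nm) :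
    Marked (set k .n v U) (k :: ns) := by
  intro k' v' h'
  rcases get_set _ _ _ _ _ _ _ h' with ⟨h1, _, _⟩ | h1
  · rw [← h1]; exact ⟨hk, by simp⟩
  · exact ⟨(h _ _ h1).1, List.mem_cons_of_mem _ (h _ _ h1).2⟩

theorem markReps_spec {T : Tr} (hT : Val T) (l : List (ℕ × List ℕ)) {U : Tr} {ns : List Nm}
    {R : Tr × List Nm} (hU : Marked U ns) (h : markReps T l U ns = some R) : Marked R.1 R.2 := by
  induction l generalizing U ns with
  | nil =>
    simp only [markReps, Option.some.injEq] at h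
    rw [← h]; exact hU
  | cons c l ih =>
    unfold markReps at h
    split at h
    · cases h
    · next hc => exact ih (hU.set (good_of_toks hT _ _ (isT_spec hc)) _) h

theorem markOrb_spec {T : Tr} (hT : Val T) (l : List ℕ) {U : Tr} {ns : List Nm}
    {R : Tr × List Nm} (hU : Marked U ns) (h : markOrb T l U ns = some R) : Marked R.1 R.2 := by
  induction l generalizing U ns with
  | nil =>
    simp only [markOrb, Option.some.injEq] at h
    rw [← h]; exact hU
  | cons c l ih =>
    unfold markOrb at h
    split at h
    · cases h
    · next q hq =>
      split at h
      · cases h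
      · next v hv =>
        exact ih (hU.set (good_of_M hT (Nat.mod_lt _ (by norm_num)) hq (hU _ _ hv).1) _) h

/-- The image of `k` under the letter `g` is the base point or marked. -/
def closed1 (T U : Tr) (k : Nm) (g : L) : Bool :=
  match fwd T [g] k with
  | none => false
  | some [] => true
  | some (a :: q) => (get (a :: q) U .n).isSome

def closedAll (T U : Tr) : List Nm → Bool
  | [] => true
  | k :: l =>
    closed1 T U k .x && closed1 T U k .X && closed1 T U k .y && closed1 T U k .t && closedAll T U l

theorem closed1_spec {T U : Tr} (hT : Val T) {ns : List Nm} (hU : Marked U ns) {k : Nm} {g : L}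
    (h : closed1 T U k g = true) :
    ∃ q, (gm g)⁻¹ • e k = e q ∧ (q = [] ∨ (Good q ∧ q ∈ ns)) := by
  unfold closed1 at h
  split at h
  · cases h
  · next hq =>
    refine ⟨[], ?_, Or.inl rfl⟩
    rw [e_fwd hT _ _ _ hq]; simp [gw]
  · next a q hq =>
    refine ⟨a :: q, ?_, Or.inr ?_⟩
    · rw [e_fwd hT _ _ _ hq]; simp [gw]
    · obtain ⟨v, hv⟩ := Option.isSome_iff_exists.mp h
      exact hU _ _ hv

theorem closedAll_spec {T U : Tr} {l : List Nm} (h : closedAll T U l = true) {k : Nm}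
    (hk : k ∈ l) : closed1 T U k .x = true ∧ closed1 T U k .X = true ∧ closed1 T U k .y = true ∧
      closed1 T U k .t = true := by
  induction l with
  | nil => cases hk
  | cons a l ih =>
    simp only [closedAll, Bool.and_eq_true] at h
    rcases List.mem_cons.mp hk with rfl | hk
    · exact ⟨h.1.1.1.1, h.1.1.1.2, h.1.1.2, h.1.2⟩
    · exact ih h.2 hk

def final (orb : List ℕ) (T : Tr) : Bool :=
  match markReps T reps .nil [] with
  | none => false
  | some (U, ns) =>
    match markOrb T orb U ns with
    | none => false
    | some (U', ns') => closedAll T U' ([] :: ns')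

theorem final_spec {orb : List ℕ} {T : Tr} (hT : Val T) (h : final orb T = true) (z : G ⧸ M) :
    z = base ∨ ∃ k, z = e k ∧ Good k := by
  unfold final at h
  split at h
  · cases h
  next U ns h1 =>
  split at h
  · cases h
  next U' ns' h2 =>
  have hU0 : Marked .nil [] := by
    intro k v hk
    rw [get_nil] at hk
    cases hk
  have hU : Marked U ns := markReps_spec hT _ hU0 h1
  have hU' : Marked U' ns' := markOrb_spec hT _ hU h2
  have key := univ_of_closed {z | ∃ k, z = e k ∧ (k = [] ∨ (Good k ∧ k ∈ ns'))}
    ⟨[], rfl, Or.inl rfl⟩ (by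
      rintro l z ⟨k, rfl, hk⟩
      have hk' : k ∈ [] :: ns' := by
        rcases hk with rfl | hk
        · simp
        · exact List.mem_cons_of_mem _ hk.2
      have hc := closedAll_spec h hk'
      cases l
      · exact closed1_spec hT hU' hc.1
      · exact closed1_spec hT hU' hc.2.1
      · exact closed1_spec hT hU' hc.2.2.1
      · exact closed1_spec hT hU' hc.2.2.2
      · exact ⟨k, by simp [gm], hk⟩)
  have hz : z ∈ {z | ∃ k, z = e k ∧ (k = [] ∨ (Good k ∧ k ∈ ns'))} := by rw [key]; trivial
  obtain ⟨k, rfl, rfl | hk⟩ := hz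
  · exact Or.inl rfl
  · exact Or.inr ⟨k, rfl, hk.1⟩

def check (log orb : List ℕ) : Bool :=
  match run log T0 with
  | none => false
  | some T => final orb T

theorem check_spec {log orb : List ℕ} (h : check log orb = true) (z : G ⧸ M) :
    z = base ∨ ∃ k, z = e k ∧ Good k := by
  unfold check at h
  split at h
  · cases h
  · next T hT => exact final_spec (run_val _ T0_val hT) h z

/-! ### The certificate -/

def steps0 : List ℕ :=
  [24, 16801, 16384, 86032, 442376, 2220040, 11108360, 961, 55551513, 11108489,
   16392, 90881, 16777, 86040, 446480, 442401, 2220056, 11116961, 11108376, 55549976,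
   277766561, 90136, 467361, 446472, 446464, 2244608, 2244616, 11116544, 11116552, 55558152,
   55558144, 277766152, 277766144, 466944, 466952, 2240520, 2240528, 11214856, 56083081, 2240536,
   11214872, 56091041, 2236432, 11194368, 11231881, 2236416, 2236440, 11198480, 11194401, 11227136,
   11227160, 56082456, 280428961, 11231256, 56172560, 55975969, 11231240, 55586840, 55586832, 277950480,
   277946401, 55590928, 277946377, 55586816, 277938176, 277939737, 55590936, 277966872, 1389851041, 55590920,
   277962760, 1389822721, 1389821968, 6949122057, 277798936, 277798920, 277798928, 1389006856, 6945043081, 277794816,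
   1388978176, 1388979737, 1389002760, 6945022721, 277946376, 1389740681, 55587249, 1388978192, 56139785, 56164360,
   280830721, 277794840, 277794832, 1388986392, 6944948641, 280829968, 1404162057, 1388986368, 1388839561, 1388838936,
   6944210960, 6944935969, 1388838920, 1388834840, 6944190480, 6945042465, 1388834816, 11186176, 11187737, 55934976,
   279678977, 279678992, 1398407177, 1398407176, 277963033, 6992044048, 56139809, 34960232456, 174801171081, 2338840,
   2338816, 11698176, 11699737, 11186730, 2236826, 11218964, 6944178176, 11698825, 34720894976, 173604478977,
   2338832, 11706401, 173604478992, 868022407177, 11706368, 2343561, 2342920, 11722760, 58622721, 58621968,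
   293122057, 2342936, 11210776, 11214848, 174801170440, 874005861001, 56164368, 174801170705, 56164617, 280830362,
   34960232460, 34960232468, 174801170444, 174801170453, 6992044036, 874005860364, 56082436, 56082445, 56082461, 1398407172,
   55975949, 55975964, 279678990, 6945042436, 6945042454, 6945042462, 56164365, 1389006869, 293122068, 277966861,
   277966877, 58621956, 58621966, 1389002765, 11722757, 6944935957, 6944935965, 58535948, 11706380, 11706390,
   11706398, 11186200, 58495000, 292491681, 11198464, 11198472, 56004608, 56004616, 56152072, 56152064,
   280428544, 280428552, 56172552, 56172544, 277950464, 277950472, 1389764608, 1389764616, 277938200, 6944895000,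
   34724491681, 277970952, 277970944, 1389850624, 1389850632, 1389821976, 6949122072, 34745627041, 1388978200, 6944907280,
   6944903201, 280829976, 1404166160, 1404162081, 1388990464, 1388990472, 6944948224, 6944948232, 6944210952, 6944210944,
   34721067008, 34721067016, 6944190464, 6944190472, 34720964608, 34720964616, 6944178200, 34720907280, 55935009, 11698200,
   34720895000, 173604491681, 173604479000, 868022411681, 55947264, 55947272, 292491272, 292491264, 55996416, 55996440,
   173605343256, 279998521, 55996432, 279994368, 280031881, 279994392, 1399988641, 56000528, 280014856, 1400083081]

def steps1 : List ℕ :=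
  [56000520, 56000536, 280018960, 280014881, 280027160, 1400082456, 7000428961, 280027136, 280031240, 280031256,
   1399975960, 6999896481, 280768536, 280768528, 1402146832, 7010746377, 1403854872, 7019291041, 280768520, 280764416,
   280764432, 1403834368, 1402151561, 280764440, 1403834392, 7019188641, 1402146840, 7010746392, 35053748641, 1402146816,
   1402150936, 7010770960, 7019175969, 1402150920, 280870928, 280870920, 280870936, 1404366872, 7021851041, 280866840,
   280866816, 1389756416, 1404338176, 1404339737, 6948786730, 1404362760, 7021822721, 1389756440, 1389756432, 6948794368,
   6948831881, 6948794376, 34743980681, 1389760528, 6948827152, 1389760520, 6948827136, 6948831240, 1389707272, 1389707264,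
   34724491264, 34724491272, 1389862936, 1389862920, 1389862928, 6949257232, 34746298377, 6949326872, 34746651041, 1389858816,
   1389858832, 6949261328, 6949306377, 1389858840, 6949306392, 34746548641, 6949257240, 34746302480, 34746298401, 6949257216,
   34746290176, 34746291737, 6949261336, 34746322960, 34746318881, 6949261320, 34746314760, 173731582721, 173731581968, 868657922057,
   6949126144, 6949126152, 34745626624, 34745626632, 6944907264, 6944907272, 34724548616, 34724548608, 1404166152, 1404166144,
   7020843008, 7020843016, 6944956440, 6944956416, 34724786192, 55587481, 173623946794, 6949310484, 6944956697, 173623943168,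
   868119719937, 6944956432, 34724794392, 173623988641, 34724794368, 34724749961, 868119719952, 4340598611977, 6944960528, 34724745232,
   173623738377, 6944960520, 34724745216, 34724745240, 173623742480, 173623738401, 34724749336, 34724749320, 34721062920, 34721062928,
   173605339152, 868026707977, 34721062936, 173605326872, 868026651041, 34721058840, 34721058832, 173605343248, 173605306377, 173605306392,
   868026548641, 868026732560, 868026728481, 34721058816, 173605298176, 173605299737, 279986730, 173605310484, 55996826, 280018964,
   868026494976, 4340132478977, 4340132478992, 21700662407177, 173605339136, 173605339160, 868026712080, 868026708001, 173605343240, 34720956416,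
   868026699776, 868026701337, 173604786730, 868026712084, 868026712093, 4340133572636, 868026707974, 34720956699, 1403858966, 1403858974,
   4340133502976, 21700667518977, 7019290632, 35096461961, 34720956432, 173604831248, 173604794377, 21700667518992, 108503337607177, 34720956440,
   173604794392, 868023988641, 34720960520, 173604827160, 35096461336, 175482323361, 173604827136, 173604831240, 173604831256, 34720907264,
   34720907272, 173604548616, 173604548608, 58507264, 58507272, 173604491272, 173604491264, 868022411272, 868022411264, 279740416,
   1398706176, 1398707737, 6948786176, 1398706825, 6948810760, 34744062721, 279740432, 1398714376, 6993580681, 1462464528,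
   1398714377, 279744536, 279744528, 1398734856, 6993683081, 1462464520, 1462460416, 7312306192, 55558809, 36561543168,
   182807719937, 6993682440, 34968421001, 279986176, 280010760, 1400062721, 1399934992, 279987609, 6999687168, 173605298825,
   279986200, 1399947280, 868026495009, 279998472, 868026732544, 1399975936, 1399988232, 6999949328, 4340133675017, 1399988224,
   280014848, 1400082440, 280010768, 1400066056, 7000339081, 1400152064, 1400152072, 7000428544, 7000428552, 1400139792]

def steps2 : List ℕ :=
  [7000711176, 2241049, 7000711168, 7000421001, 35003559936, 175017803777, 1400139776, 7000702992, 1400141209, 35003564048,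
   35003527177, 7000702976, 35003518977, 1400139800, 7000715280, 7000711201, 1400164368, 6999883792, 34999431177, 1400164376,
   1400172552, 1400172544, 6999896072, 6999896064, 7010746376, 7019290624, 1403850760, 1403826176, 7019134977, 292540416,
   6944903961, 34746290192, 1462706185, 1403826200, 7019147280, 173731455009, 7019175936, 1403838472, 1403838464, 7019188232,
   7019188224, 7010750472, 7010750464, 35053748232, 35053748224, 7010738176, 7010762760, 35053822721, 173622747136, 447257,
   7010738200, 7010738192, 35053703168, 35053740681, 35053703192, 175268532641, 7020834816, 35104179865, 7020838920, 35104203521,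
   35104178192, 868113739785, 7010770952, 173604798464, 35053864889, 7010770944, 35053867016, 35053867008, 7010762768, 35095883792,
   175479431177, 7010762776, 1404366848, 1404362768, 7021826056, 35109139081, 1404370952, 7021850624, 7021821976, 34743980056,
   173719916961, 6948798464, 6948798472, 34743975936, 34743980040, 7021826048, 173719909001, 6948814848, 34744147976, 6948810768,
   34744078352, 173720403977, 34744164368, 34744066321, 34744164747, 34744066048, 173720334337, 7021696153, 173720334352, 868601684001,
   868601683977, 34744139792, 4340112060416, 21700560307865, 21700560306192, 7312306185, 173720711168, 173720748681, 868603559936, 4343017803777,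
   4343017803792, 7021826321, 35109138440, 175545701001, 4340112060432, 21700560314377, 108502801543168, 542514007719937, 1398715545, 21700560317619,
   21700560314372, 175545700356, 35109138436, 35109138452, 7021826052, 7021838348, 35109134356, 1404366877, 173719908357, 182807719940,
   34744164357, 6948544536, 6948544528, 34742734856, 173713683081, 6948544520, 34742730760, 173713662721, 173713661968, 868568322057,
   6948540440, 6948540432, 34742714376, 173713580681, 34742718480, 34742714401, 173622464528, 34742714377, 173622460416, 868024139776,
   868024141337, 868024164360, 4340120830721, 173713682440, 868568421001, 1400078336, 7000397713, 1400078857, 4340120830233, 7000339346,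
   35096457230, 173604810768, 6999883785, 173622460440, 173713682456, 868568428961, 173622464536, 868112334872, 4340561691041, 173622464520,
   6949330952, 6949330944, 6949322776, 6949322768, 34746630160, 34746626081, 6949326848, 34746626056, 173733139081, 34746298376,
   173731500048, 173731463177, 292544520, 1462731521, 34746650632, 34746650624, 6949298200, 6949298192, 34746503192, 173732532641,
   34724540416, 173622707865, 34724786176, 173622706825, 173623934976, 868119678977, 6949306376, 34746540048, 34746503177, 173732712448,
   868663566337, 34746318848, 173731524616, 34746290200, 173731467280, 173731463201, 34746322944, 34746322952, 173731627016, 173731627008,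
   34746314768, 173731598352, 868658003977, 173731598336, 868657997713, 173731599642, 175268532244, 868658003976, 4343290028681, 4343290028040,
   21716450149001, 173733138440, 7020843153, 868665700360, 4343328510601, 34746314776, 173731586072, 868657947041, 173731581976, 868657922072,
   4343289627041, 868657922056, 173731586048, 4343289619081, 34745634832, 173728141328, 173728186377, 34745634840, 173728190480, 173728186401,
   34745634816, 868024139792, 4340120711201, 55591577, 173728178192, 868112306185, 868640903168, 4343204519937, 4343204519960, 4343328513073]

def steps3 : List ℕ :=
  [173622465946, 173605326861, 173605326869, 173605326877, 34742730765, 34742734860, 173713682444, 173713682454, 173713682462, 868568420372,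
   4340120829956, 4340120829966, 868024164357, 868024164372, 1399975940, 1399975957, 1399975965, 7000395788, 6999883780, 6999883796,
   868024168460, 1400078348, 868024066068, 34999431172, 34999431180, 173604794381, 173604794397, 280014861, 7019290652, 35003518990,
   280010765, 1403854861, 7000420373, 1403850764, 173713580036, 7019261966, 34742714372, 34742714390, 34742714398, 868112334869,
   868112334878, 868640718860, 173728186390, 173728186398, 868112333617, 21716022616713, 21716022616322, 868665700356, 868665700366, 868665700374,
   173733138436, 173733138452, 34746626070, 34746626078, 34746638349, 34724544524, 868663566348, 173732712462, 173732712468, 34746540037,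
   1462730756, 292544517, 173731598340, 173731598356, 868657995798, 868658003972, 868658003980, 173731586054, 173731586070, 173731586078,
   4343290028046, 4343290028054, 173623731865, 173623730818, 35095883788, 35095883796, 7019175949, 7019175957, 7019175965, 175479431172,
   173623975948, 34724794381, 34724794397, 35053821966, 108503337607578, 7000715286, 7000715294, 4343204520353, 21700667519113, 173604549131,
   173604544518, 34721067665, 35104219136, 175521101465, 35003588608, 175017949073, 35003589002, 34724810757, 34724810766, 34745638920,
   173728203401, 34724540432, 173622714377, 175017947145, 868022751240, 4340113765001, 4340120711168, 21700603559937, 34745638936, 35096461320,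
   175482315401, 175482314760, 877411582721, 4340113764360, 21700568830721, 868022751513, 4340113764497, 173728210960, 868022751265, 173604540416,
   877411582601, 868568322056, 4342841619081, 4342841619201, 175521099792, 868657934345, 21716450148360, 108582250750721, 868022464793, 21716450148497,
   173728137240, 34724540440, 173622714392, 868113588641, 173622751256, 35104223256, 7020838936, 35104210960, 868022464545, 7020834840,
   35104190480, 4343328509985, 35104219160, 175521112080, 21716450148385, 34724798472, 34724798464, 34724786200, 173623943192, 868119719960,
   4340598616080, 4340598612001, 173623988232, 173623988224, 173623742472, 173623742464, 868118724616, 868118724608, 173605330952, 173605330944,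
   868026650624, 868026650632, 4340133675016, 173605298200, 868026507280, 34998439969, 4340132479000, 21700662407192, 108503312052641, 868026699800,
   4342841618456, 21714208108961, 868026724376, 4340133638160, 868022747169, 173604786200, 4340133503000, 21700667531681, 21700667519000, 108503337611280,
   108503337607201, 173604798472, 868023988232, 868023988224, 868024152072, 868024152064, 175482322944, 175482322952, 173604540440, 868022718480,
   173728202785, 292540440, 35104202776, 175521030561, 7021862936, 1462718521, 1399935000, 6999687192, 34998452641, 1400061976,
   35003559960, 175017816481, 1399947264, 6999748616, 1400000536, 1400000528, 7000018960, 7000014881, 7000014856, 35000083081,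
   1400000520, 4340133666816, 21700668338176, 108503341694977, 4340133666840, 4340133666832, 21700668383248, 21700668346377, 4340133257216, 21700666291865,
   21700668350480, 108503341928448, 542516709646337, 6999949320, 6999949336, 34999762960, 34999758881, 34999758848, 6999945216, 6999945240,
   34999742480, 35000082465, 7000764432, 35003834368, 35002151561, 7000764440, 7000764416, 7000768528, 35002146832, 175010746377,
   7000768536, 7000768520, 35002146840, 175010750480, 175010746401, 35002146816, 35003564056, 175017832472, 7000703000, 35003527192]

def steps4 : List ℕ :=
  [175017652641, 7000866832, 35004346368, 34999489161, 34999488520, 34999488536, 35053740056, 175268716560, 175268519969, 7019135000,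
   1462706200, 7313547681, 7019147264, 7019200536, 7019200528, 35095945232, 175479738377, 35096014872, 175480091041, 7019196432,
   35095994368, 35095949961, 7019196416, 35095986217, 7019196826, 35096018964, 35096018972, 175480090652, 7019200517, 35096014860,
   175479738390, 7019196440, 34746662936, 35095998521, 35095949320, 35095949336, 175479975960, 877399896481, 35095945240, 173731622936,
   868658131361, 34743996440, 173719998521, 35095945216, 35053760528, 175268814856, 876344083081, 35053760520, 35053760536, 175268818960,
   175268814881, 35053756432, 175268794368, 175268749961, 35053756416, 175268786217, 35053756826, 175268818964, 175268818973, 876344107036,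
   175268814862, 35053756440, 175268798480, 175268794401, 175268749336, 876343762960, 876343975969, 175268749320, 175268745216, 175268745240,
   876343742480, 876344082465, 35053695000, 868113739800, 4340568715681, 35104178200, 175520907280, 175520903201, 35053862920, 35053862928,
   868023996432, 175269326881, 175269339152, 876346707977, 4340119949328, 4340119994377, 868023996416, 4340119986192, 173604541081, 21700599946794,
   174998827028, 868023996697, 7021862928, 35109326856, 175546643081, 35109257216, 35109257240, 175546302480, 175546642465, 35109126144,
   34743996416, 173719986192, 279741081, 868599946667, 175546302486, 175546302494, 868026732954, 7000018966, 7000018974, 868026662928,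
   877731524617, 173713661976, 868568326160, 868568322081, 34742718464, 34742718472, 173713604616, 173713604608, 868112306200, 4340120703000,
   21700603531681, 868112318464, 868112318472, 868568428552, 868568428544, 868112338952, 868112338944, 4340561690632, 4340561690624, 34746662928,
   173733330960, 173733326881, 173733257232, 868666298377, 34746658840, 34746658832, 173733306392, 868666548641, 173733261328, 173733306377,
   34746658816, 34746630144, 34746630152, 173733163008, 173733163016, 173733261336, 173733261320, 173733257240, 173733257216, 34746507264,
   175268794376, 868119720473, 876343980048, 175268786185, 4381719912448, 21908599566337, 34746507272, 876343975936, 4381719883777, 173732532224,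
   173732532232, 173622706200, 868113547280, 173623935009, 868119679000, 175017947160, 173731467264, 173731467272, 868657348616, 868657348608,
   173731618832, 868658106368, 868658143881, 173731622920, 868658143256, 868658143240, 4343290724360, 21716453630721, 35095994376, 175479980681,
   175520907264, 7019135897, 173731590152, 173731590144, 868657946624, 868657946632, 868657926152, 868657926144, 4343289626624, 4343289626632,
   4343289618456, 21716448108560, 868657934369, 173728190464, 173728190472, 868640964608, 173728178200, 868640903192, 4343204532641, 175521099800,
   877605515280, 877605511201, 21700603559960, 175482314776, 877411590561, 173728210944, 173728210952, 877411581976, 4387057926160, 868022706209,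
   868641067016, 868641067008, 173622718472, 173622718464, 868113588232, 868113588224, 35104210944, 175521067008, 175521067016, 175520964616,
   877605572616, 173623996416, 868119986192, 34724541081, 4340599946794, 868666314760, 4343331582721, 173623996432, 868119949328, 868119994377,
   868119994376, 4340599980681, 173623996440, 868026662936, 868119998521, 868119994392, 4340599988641, 4340598616072, 4340598616064, 868119949336,
   868119949320, 868118720520, 868118720536, 868118720528, 4340593627152, 21702968147977, 4340593618960, 4340593614881, 868118716440, 868118716416]

def steps5 : List ℕ :=
  [868118716432, 4340593631248, 4340593594377, 4340593631256, 4340593631240, 4340593627136, 4340593627160, 21702968152080, 21702968148001, 868026658816,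
   868026658840, 868026658832, 4340133306368, 4340133261961, 4340133306392, 21700666548641, 4340133261336, 21700668383240, 108503341924360, 542516709630721,
   542516709629968, 2712583548162057, 868026507272, 868026507264, 4340132548608, 4340132548616, 21700662411272, 21700662411264, 108503312052232, 108503312052224,
   4340133515272, 21714208108544, 4340133638152, 4340133638144, 21700668203016, 21700668203008, 868023947264, 108503337611272, 542516688064528, 21702993084465,
   542516688068608, 21702993085065, 868662665216, 4343313331865, 2712583440347136, 175010738192, 280031897, 868662669320, 4343313355521, 173605344410,
   4381719883780, 4381719883789, 173732544518, 173732540432, 34746508697, 173732540809, 21714208108937, 868662669328, 868662714377, 876343980689,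
   4343313355017, 4343313357362, 175545634828, 35109126164, 35109126172, 173719916572, 7021821956, 7021821964, 34743980036, 1404362756,
   1404362772, 7021694988, 6948794372, 6948794388, 280870917, 280870932, 280870940, 1462460428, 1404338188, 6948831236,
   1389756429, 1389756444, 279744516, 279744540, 1404370956, 277946381, 6948798468, 6948798476, 7021850628, 7021862940,
   34743996444, 34744000532, 34744000540, 35109257236, 35109257245, 35109330957, 175521067346, 173719998468, 35000107036, 1400000517,
   1400000524, 175546642460, 21700666290181, 868658130964, 868658130973, 7000014860, 7000010765, 877731524614, 175479742493, 4340133515276,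
   35000082453, 35000082461, 21714208108548, 21700667584534, 108571040546822, 108571040546838, 4381719912858, 175268798484, 175268798493, 876344004637,
   34746324498, 876344082438, 876344082454, 876344082462, 6999945609, 35053748507, 877411590166, 877411590174, 6999946522, 876343762964,
   7020844977, 876343755275, 868641058820, 868641058829, 108503017816086, 108503017816094, 35096461722, 4387057926164, 4387057926174, 21935289643038,
   876343756347, 4381719912454, 4381719912462, 4381719912468, 876343980038, 876343980046, 173732540699, 4340567748630, 4340567748638, 175482316339,
   4343286751237, 868662665220, 4343313330182, 21702993084698, 21702993088517, 6949307546, 868662714372, 868662714381, 868662714388, 4343313358854,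
   173732540421, 173732540429, 4343289636123, 4343286747140, 4343286747149, 542516688064517, 542516688064532, 868026662932, 868026662940, 2712583440334862,
   4340133326861, 4340133330956, 868119998484, 868119998493, 4340599988252, 868119994374, 868119994382, 4340133307802, 868657954829, 108503341928461,
   108503341928468, 21700668383237, 21700668383244, 108503341924366, 173731464346, 542516709629958, 542516709629966, 542516709629972, 2712583548162052, 4340119994372,
   4340119994389, 4340119994396, 21700599758868, 173732532229, 173732532236, 173732532252, 175269326860, 4340119949317, 4340119986196, 868662669324,
   34746503172, 34746503181, 876346707988, 4343289634821, 21700599943173, 21700599943180, 4343313354766, 4343313354774, 173731500037, 173731500052,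
   174998798350, 868657512461, 868112308914, 4343289741317, 4343289741325, 4340133257483, 34999754757, 21700603560346, 868640907286, 868640907294,
   34999760154, 108582240555029, 108582240555037, 21700666535950, 175521031443, 21702993084422, 21702993084429, 21702993084436, 35095994380, 35095994389,
   2712583440347140, 2712583440347149, 175479980044, 175479980052, 21702993092637, 13562917201739780, 877604540430, 21716453629956, 21716453629965, 35095998468,
   875053703188, 4343290724358, 4343290724374, 173733330964, 173733330972, 175010738189, 868666667036, 34746662917, 108503341694988, 108503341694996]

def steps6 : List ℕ :=
  [173733326860, 21700668338189, 175268810757, 175268810766, 35002150932, 35003854869, 175019175948, 175521132557, 175521132573, 35003834389,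
   35104210949, 35104210973, 35104203707, 4342841643028, 4342841643036, 868568326172, 868568322053, 868568322060, 173713661957, 173713661965,
   4342841618445, 4342841618453, 4342841618461, 7020839219, 4388027871236, 877605572628, 175010747674, 34998452244, 34998452253, 6999691293,
   175268746393, 1400063537, 868665820842, 173733306373, 173733306396, 877604548617, 35104178747, 4340567949318, 1404167194, 868641062918,
   868022461466, 877604548613, 877604548629, 877604548637, 4340593594372, 21702968168470, 4343204532882, 21702968164358, 542516709649963, 21700668346374,
   21700668346382, 21700668346389, 35002148122, 877399896084, 868118716826, 4340593618964, 4340593618974, 21702968107036, 4340593614860, 21702968147998,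
   21700668351673, 4340593612731, 108514840772628, 108514840772636, 21702968152093, 4340593610758, 876343754757, 34745640218, 21700666548244, 21700666548252,
   4340133310492, 4340133306372, 4340133306381, 868026658821, 868026658829, 21716448108550, 21716448108566, 21716448108574, 868640904347, 4340561547285,
   4340561547294, 868665819142, 868665819150, 4340593631642, 876343742484, 876343742493, 4381718724637, 4340561597619, 4340599754758, 868118727730,
   175017816085, 175017816093, 173733158918, 173733158926, 7000327091, 34998751236, 6999748628, 1399947268, 6999740444, 21700668198917,
   173733164458, 35095740428, 7019147284, 7019147293, 35095748637, 7000326970, 173733310486, 173733310494, 21700668194865, 4340120768905,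
   175482323099, 21700662747150, 21700668195242, 877411622917, 877411622925, 4340133638426, 108503312064518, 35003531915, 175017652246, 175017652254,
   35003532033, 4340132548763, 108503341019150, 4340120704154, 21700662751237, 21700662751245, 21700568831002, 108503341023238, 21702808457498, 21702808461317,
   877411618836, 21700668194821, 21700668194829, 35003567282, 4343204827148, 868640964629, 868640964637, 4340113764357, 4340113764365, 35003533874,
   4340119740428, 868023947284, 868024154802, 4340567945228, 868113588237, 868113588245, 868113588253, 868666314766, 868666318861, 280429722,
   4343331581957, 4343331581965, 4343331581972, 4340599758869, 4340599980037, 4340599943180, 175268716573, 868666290189, 35053863449, 35095692571,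
   868113596422, 868113596430, 877605517491, 877604831236, 175520964628, 21702808457865, 21702808459193, 868658144538, 4340568715284, 4340568715293,
   175268491293]

def orbs0 : List ℕ :=
  [88, 85, 432, 54249, 2168, 10849, 2188, 2185, 2194, 10948,
   10971, 10925, 10934, 10965, 6786252, 54625, 57126, 54827, 274248, 1357250,
   6781426, 11424, 1371253, 1357127, 6782133, 271449, 1356284, 33907125, 1356427, 2284,
   1356433, 271424, 54289, 271256, 54857, 6782127, 271284, 456, 6781450, 2289,
   54284, 10857, 271290, 1356288, 54258, 6782251, 271438, 54688, 54685, 54694,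
   1356439, 1367268, 33910891, 273425, 273434, 274187, 273468, 273465, 33907195, 6782188,
   6782185, 6782178, 1367248, 1370932, 1369290, 1367125, 847682126, 6846427, 21192053132, 169535969,
   54836, 1370925, 1367348, 33907191, 1367325, 1369287, 169535965, 6781438, 169554432, 33910925,
   6846450, 33907187, 33910885, 273859, 34183166, 105960290635, 848298752, 6846435, 6835634, 856847251,
   169536424, 4238410625, 4238399135, 34232125, 34232134, 4238399124, 847773127, 274191, 6854625, 169659626,
   34273888, 6836625, 6836634, 847679825, 169554625, 169554634, 169554427, 4238865832, 169535925, 170915825,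
   170915967, 21192058126, 4241493768, 169659750, 171369451, 34232168, 6785684, 34178165, 848298767, 847678426,
   33907284, 6786427, 169536449, 169656424, 21191995665, 847767326, 34281424, 171160665, 4238411627, 847765926,
   1428426, 33931924, 34183195, 34183134, 34183168, 169553426, 847773165, 169656389, 169553433, 847682349,
   33931949, 1357136, 285687, 1367357, 170915855, 847678184, 857036633, 169535684, 34179189, 6781456,
   169536434, 6786387, 1357284, 34232290, 33907289, 169553186, 33931284, 848282134, 169656449, 169553464,
   171407133, 6856284, 171407327, 34281449, 847682324, 169659633, 847678464, 169656384, 33910684, 6786449,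
   33931277, 169553190, 6786391, 34281469, 169536469, 6785688, 33910638, 33910695, 57136, 169659693,
   6835838, 4241410667, 21191961749, 169535636, 106037354249, 33907136, 33907294, 6856295, 847682353, 1357276,
   33931934, 271456, 6786434, 169536467, 6846457, 6856291, 6786256, 847765950, 34281467, 33931289,
   21207053337, 1371256, 4241531750, 34232293, 169535692, 169656438, 6782136, 1357289, 847678471, 33931954,
   169553470, 6786455, 847678188, 21207470849, 33931956, 847682357, 1367178, 847765939, 169659788, 169659794,
   6836259, 4238411785, 4238411794, 34232187, 6835888, 6835885, 171407259, 169656456, 4238829685, 848211358,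
   34181784, 34273386, 34273139, 848298968, 1370937, 21192053139, 171407136, 33932257, 4238860970, 6836357,
   21192058938, 21194148887, 848298776, 34179453, 105960290639, 6846436, 171160925, 171160934, 6836684, 33932287,
   34179425, 171160887, 169659637, 4238411386, 4241410676, 848282294, 105960265679, 847772189, 4238860966, 171407295,
   855804664, 4241056785, 34232179, 170908934, 6854676, 171366925, 169554684, 855804293, 21191995636, 33932139,
   6854685, 34183136, 4238411757, 848210964, 847772186, 4238865837, 169661294, 171369459, 855804424, 847772193,
   1367338, 169659759, 169661387, 4238829776, 21192058793, 4238399191, 33928436, 847679689, 529801453194, 34232188,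
   847678437, 34273391, 4238392192, 847765959, 6786456, 169553437, 6836689, 847767137, 848298194, 847682276,
   529801474266, 4238410692, 169554437, 171367167, 171160889, 21395116764, 169642195, 848298757, 33910936, 169661389,
   847773390, 857036639, 4241493777, 847679686, 34273425, 4238399184, 4238411390, 33932279, 169535939, 847679838,
   847682137, 169536456, 847679676, 169554679, 4285183195]

def log : List ℕ :=
  steps0 ++ (steps1 ++ (steps2 ++ (steps3 ++ (steps4 ++ (steps5 ++ steps6)))))

theorem check_ok : check log orbs0 = true := by
  decide +kernel

open Pointwise in
theorem primitive_aux : ∀ B : Set (G ⧸ M), MulAction.IsBlock G B →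
    B.Subsingleton ∨ B = Set.univ := by
  intro B hB
  by_cases hs : B.Subsingleton
  · exact Or.inl hs
  right
  rw [Set.not_subsingleton_iff] at hs
  obtain ⟨a, ha, b, hb, hab⟩ := hs
  obtain ⟨g, hg⟩ : ∃ g : G, g • a = base := by
    obtain ⟨g, hg⟩ := MulAction.exists_smul_eq G a base
    exact ⟨g, hg⟩
  have hB' : MulAction.IsBlock G (g • B) := hB.translate g
  have h0 : base ∈ g • B := hg ▸ Set.smul_mem_smul_set ha
  have h1 : g • b ∈ g • B := Set.smul_mem_smul_set hb
  rcases check_spec check_ok (g • b) with h | ⟨k, hk, hgood⟩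
  · exact absurd (smul_left_cancel g (hg.trans h.symm)) hab
  · have h2 : g • B = Set.univ := hgood _ hB' h0 (hk ▸ h1)
    rw [smul_eq_iff_eq_inv_smul] at h2
    rw [h2, Set.smul_set_univ]

end Chk

/-- The action of `G` on `G ⧸ 𝓜` is primitive: every `G`-invariant block is
trivial (a subsingleton or the whole space). -/
theorem primitive_action :
    ∀ B : Set (G ⧸ M), MulAction.IsBlock G B →
      B.Subsingleton ∨ B = Set.univ :=
  Chk.primitive_aux

end M22
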